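/- Let γ > 0, c := coth γ, and φ_γ(x) := (cosh γ · cos x − 1)/(sinh γ · (cosh γ − cos x)). Then ∫_{-π}^{π} φ_γ(x)·(φ_γ′(x))² dx = (π/4)·(c² − 1)², where φ_γ′ denotes the derivative of φ_γ; in particular this integral is positive. -/

import Mathlib

open MeasureTheory

/-- The 2π-periodic Benjamin–Ono travelling wave profile with parameter `γ`. -/
noncomputable def boWave (γ : ℝ) (x : ℝ) : ℝ :=
  (Real.cosh γ * Real.cos x - 1) / (Real.sinh γ * (Real.cosh γ - Real.cos x))

theorem cosh_sub_cos_pos {γ : ℝ} (hγ : 0 < γ) (x : ℝ) : 0 < Real.cosh γ - Real.cos x := by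
  linarith [Real.one_lt_cosh.2 hγ.ne', Real.cos_le_one x]

theorem hasDerivAt_cosh_sub_cos (γ x : ℝ) :
    HasDerivAt (fun y => Real.cosh γ - Real.cos y) (Real.sin x) x := by
  simpa using (Real.hasDerivAt_cos x).const_sub (Real.cosh γ)

theorem boWave_eq {γ : ℝ} (hγ : 0 < γ) (x : ℝ) :
    boWave γ x =
      Real.sinh γ / (Real.cosh γ - Real.cos x) - Real.cosh γ / Real.sinh γ := by
  have hS := (Real.sinh_pos_iff.2 hγ).ne'
  have hD := (cosh_sub_cos_pos hγ x).ne'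
  rw [boWave]
  field_simp
  linear_combination Real.cosh_sq γ

theorem hasDerivAt_boWave {γ : ℝ} (hγ : 0 < γ) (x : ℝ) :
    HasDerivAt (boWave γ)
      (-(Real.sinh γ * Real.sin x) / (Real.cosh γ - Real.cos x) ^ 2) x := by
  rw [funext (boWave_eq hγ)]
  have h := ((hasDerivAt_const x (Real.sinh γ)).fun_div (hasDerivAt_cosh_sub_cos γ x)
    (cosh_sub_cos_pos hγ x).ne').sub_const (Real.cosh γ / Real.sinh γ)
  simpa using h

/-- `x + 2 arctan (r sin x / (1 - r cos x))` with `r = exp (-γ)` is an antiderivative of the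
Poisson kernel `sinh γ / (cosh γ - cos x)` on the whole real line. -/
theorem hasDerivAt_poisson_antideriv {γ : ℝ} (hγ : 0 < γ) (x : ℝ) :
    HasDerivAt (fun y => y + 2 * Real.arctan
        (Real.exp (-γ) * Real.sin y / (1 - Real.exp (-γ) * Real.cos y)))
      (Real.sinh γ / (Real.cosh γ - Real.cos x)) x := by
  have hr0 := Real.exp_pos (-γ)
  have hr1 : Real.exp (-γ) < 1 := Real.exp_lt_one_iff.2 (by linarith)
  have hD := (cosh_sub_cos_pos hγ x).ne'
  have hE : (1 - Real.exp (-γ) * Real.cos x) ≠ 0 := by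
    nlinarith [Real.cos_le_one x]
  have h := (hasDerivAt_id x).add (((((Real.hasDerivAt_sin x).const_mul (Real.exp (-γ))).fun_div
    (((Real.hasDerivAt_cos x).const_mul (Real.exp (-γ))).const_sub 1) hE).arctan).const_mul 2)
  refine h.congr_deriv ?_
  rw [Real.sinh_eq, Real.cosh_eq] at *
  have hm : Real.exp γ = (Real.exp (-γ))⁻¹ := by rw [Real.exp_neg, inv_inv]
  rw [hm] at hD ⊢
  generalize Real.exp (-γ) = r at *
  have hsc := Real.sin_sq_add_cos_sq x
  generalize Real.sin x = s at *
  generalize Real.cos x = c at *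
  have hQ : (1 - r * c) ^ 2 + (r * s) ^ 2 ≠ 0 := by positivity
  have hQ' : (r⁻¹ + r) / 2 - c = ((1 - r * c) ^ 2 + (r * s) ^ 2) / (2 * r) := by
    field_simp
    linear_combination (-r ^ 2) * hsc
  have h1 : 1 + (r * s / (1 - r * c)) ^ 2 = ((1 - r * c) ^ 2 + (r * s) ^ 2) / (1 - r * c) ^ 2 := by
    field_simp
  rw [hQ', h1]
  field_simp
  linear_combination (-r ^ 2) * hsc

theorem hasDerivAt_sin_div_pow {γ : ℝ} (hγ : 0 < γ) (k : ℕ) (x : ℝ) :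
    HasDerivAt (fun y => Real.sin y / (Real.cosh γ - Real.cos y) ^ (k + 1))
      (Real.cos x / (Real.cosh γ - Real.cos x) ^ (k + 1)
        - (k + 1) * Real.sin x ^ 2 / (Real.cosh γ - Real.cos x) ^ (k + 2)) x := by
  have hD := (cosh_sub_cos_pos hγ x).ne'
  have h := (Real.hasDerivAt_sin x).fun_div ((hasDerivAt_cosh_sub_cos γ x).fun_pow (k + 1))
    (pow_ne_zero _ hD)
  refine h.congr_deriv ?_
  push_cast
  field_simp
  ring

/-- An antiderivative of `boWave γ * (boWave γ)' ^ 2`. -/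
noncomputable def boWaveAntideriv (γ x : ℝ) : ℝ :=
  -(Real.sinh γ ^ 3 / 4) * (Real.sin x / (Real.cosh γ - Real.cos x) ^ (3 + 1))
  + 5 * Real.cosh γ * Real.sinh γ / 12 * (Real.sin x / (Real.cosh γ - Real.cos x) ^ (2 + 1))
  + (Real.cosh γ ^ 2 - 3 * Real.sinh γ ^ 2) / (24 * Real.sinh γ)
    * (Real.sin x / (Real.cosh γ - Real.cos x) ^ (1 + 1))
  + Real.cosh γ * (3 * Real.cosh γ ^ 2 - 5 * Real.sinh γ ^ 2) / (24 * Real.sinh γ ^ 3)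
    * (Real.sin x / (Real.cosh γ - Real.cos x) ^ (0 + 1))
  + 1 / (8 * Real.sinh γ ^ 4) * (x + 2 * Real.arctan
      (Real.exp (-γ) * Real.sin x / (1 - Real.exp (-γ) * Real.cos x)))

theorem hasDerivAt_boWaveAntideriv {γ : ℝ} (hγ : 0 < γ) (x : ℝ) :
    HasDerivAt (boWaveAntideriv γ) (boWave γ x * (deriv (boWave γ) x) ^ 2) x := by
  have hS := (Real.sinh_pos_iff.2 hγ).ne'
  have hD := (cosh_sub_cos_pos hγ x).ne'
  have h := (((((hasDerivAt_sin_div_pow hγ 3 x).const_mul (-(Real.sinh γ ^ 3 / 4))).add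
    ((hasDerivAt_sin_div_pow hγ 2 x).const_mul (5 * Real.cosh γ * Real.sinh γ / 12))).add
    ((hasDerivAt_sin_div_pow hγ 1 x).const_mul
      ((Real.cosh γ ^ 2 - 3 * Real.sinh γ ^ 2) / (24 * Real.sinh γ)))).add
    ((hasDerivAt_sin_div_pow hγ 0 x).const_mul
      (Real.cosh γ * (3 * Real.cosh γ ^ 2 - 5 * Real.sinh γ ^ 2) / (24 * Real.sinh γ ^ 3)))).add
    ((hasDerivAt_poisson_antideriv hγ x).const_mul (1 / (8 * Real.sinh γ ^ 4)))
  refine h.congr_deriv ?_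
  rw [(hasDerivAt_boWave hγ x).deriv, boWave_eq hγ, div_pow, neg_sq, mul_pow, Real.sin_sq]
  have hCS := Real.cosh_sq γ
  obtain ⟨u, hu⟩ : ∃ u, u = Real.cosh γ - Real.cos x := ⟨_, rfl⟩
  have hc : Real.cos x = Real.cosh γ - u := by linarith
  rw [← hu] at hD ⊢
  rw [hc]
  generalize Real.cosh γ = C at *
  generalize Real.sinh γ = S at *
  push_cast
  field_simp
  have h2 : S ^ 2 = C ^ 2 - 1 := by linarith
  have h4 : S ^ 4 = (C ^ 2 - 1) ^ 2 := by rw [← h2]; ring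
  have h6 : S ^ 6 = (C ^ 2 - 1) ^ 3 := by rw [← h2]; ring
  ring_nf
  simp only [h2, h4, h6]
  ring

theorem continuous_boWave_mul_deriv_sq {γ : ℝ} (hγ : 0 < γ) :
    Continuous fun x => boWave γ x * (deriv (boWave γ) x) ^ 2 := by
  have hd : deriv (boWave γ) = fun x =>
      -(Real.sinh γ * Real.sin x) / (Real.cosh γ - Real.cos x) ^ 2 :=
    funext fun x => (hasDerivAt_boWave hγ x).deriv
  have hD := fun x => (cosh_sub_cos_pos hγ x).ne'
  simp only [hd, boWave_eq hγ]
  fun_prop (disch := intro x; first | exact hD x | exact pow_ne_zero 2 (hD x))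

theorem integral_boWave_mul_deriv_sq {γ : ℝ} (hγ : 0 < γ) :
    ∫ x in (-Real.pi)..Real.pi, boWave γ x * (deriv (boWave γ) x) ^ 2
      = Real.pi / (4 * Real.sinh γ ^ 4) := by
  rw [intervalIntegral.integral_eq_sub_of_hasDerivAt
    (fun x _ => hasDerivAt_boWaveAntideriv hγ x)
    ((continuous_boWave_mul_deriv_sq hγ).intervalIntegrable _ _)]
  simp only [boWaveAntideriv, Real.sin_neg, Real.sin_pi, neg_zero, mul_zero, zero_div,
    Real.arctan_zero]
  ring

theorem stmt13 (γ : ℝ) (hγ : 0 < γ) :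
    (∫ x in (-Real.pi)..Real.pi, boWave γ x * (deriv (boWave γ) x) ^ 2)
      = (Real.pi / 4) * ((Real.cosh γ / Real.sinh γ) ^ 2 - 1) ^ 2 ∧
    0 < ∫ x in (-Real.pi)..Real.pi, boWave γ x * (deriv (boWave γ) x) ^ 2 := by
  have hS := Real.sinh_pos_iff.2 hγ
  rw [integral_boWave_mul_deriv_sq hγ]
  refine ⟨?_, by positivity⟩
  have hc : (Real.cosh γ / Real.sinh γ) ^ 2 - 1 = 1 / Real.sinh γ ^ 2 := by
    field_simp
    linear_combination Real.cosh_sq γ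
  rw [hc]
  field_simp
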